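/- Let K = ∏_{j=1}^n K_j and μ be as in the rational self-similar fractal setup with γ_j = log(#Λ_j)/log r, and let τ = (τ_1,…,τ_n) ∈ ℝ^n_{>0} satisfy Σ_{i=1}^n τ_i γ_i = 1. Define Bad_Int(K;τ) = {x ∈ K : there exists c(x) > 0 such that for every rational point p/q = (p_1/q,…,p_n/q) ∈ ℚ^n ∩ K with q ≥ 2 there is some 1 ≤ i ≤ n with |x_i − p_i/q| ≥ c(x)/(q·(log q)^{τ_i})}. Then μ(Bad_Int(K;τ)) = 0. -/

import Mathlib

open MeasureTheory
open scoped ENNReal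

/-- The set `Bad_Int(K; τ)` of weighted intrinsically badly approximable points of the
fractal `K = ∏ K_j`. -/
def BadIntTau {n : ℕ} (K : Fin n → Set ℝ) (τ : Fin n → ℝ) : Set (Fin n → ℝ) :=
  {x | (∀ j, x j ∈ K j) ∧ ∃ c : ℝ, 0 < c ∧
    ∀ (p : Fin n → ℤ) (q : ℕ), 2 ≤ q → (∀ j, ((p j : ℝ) / q) ∈ K j) →
      ∃ i, c / (q * Real.log q ^ τ i) ≤ |x i - p i / q|}

/-- The integers whose base-`r` expansions are the words of length `m` in the digits `D`. -/
def digitWords (r : ℕ) (D : Finset ℕ) : ℕ → Finset ℕ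
  | 0 => {0}
  | m + 1 => (digitWords r D m ×ˢ D).image fun p => r * p.1 + p.2

/-- The integer whose base-`r` expansion is the digit `a` repeated `s` times. -/
def repeatedDigit (r a : ℕ) : ℕ → ℕ
  | 0 => 0
  | s + 1 => r * repeatedDigit r a s + a

/-- The contraction of `ℝⁿ` whose `i`-th coordinate map is attached to the word `w i` of
length `m`. -/
noncomputable def wordMap {n : ℕ} (r m : ℕ) (w : Fin n → ℕ) (x : Fin n → ℝ) : Fin n → ℝ :=
  fun i => (x i + w i) / (r : ℝ) ^ m

theorem injOn_digit_append {r : ℕ} {D : Finset ℕ} (hD : ∀ a ∈ D, a < r) (W : Finset ℕ) :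
    Set.InjOn (fun p : ℕ × ℕ => r * p.1 + p.2) ((W ×ˢ D : Finset (ℕ × ℕ)) : Set (ℕ × ℕ)) := by
  rintro ⟨b, a⟩ h ⟨b', a'⟩ h' heq
  simp only [Finset.coe_product, Set.mem_prod, Finset.mem_coe] at h h'
  have ha := hD a h.2
  have ha' := hD a' h'.2
  simp only at heq
  have hmod := congrArg (· % r) heq
  simp only [Nat.mul_add_mod, Nat.mod_eq_of_lt ha, Nat.mod_eq_of_lt ha'] at hmod
  subst hmod
  have hb : r * b = r * b' := by omega
  rw [Nat.eq_of_mul_eq_mul_left (by omega) hb]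

theorem card_digitWords {r : ℕ} {D : Finset ℕ} (hD : ∀ a ∈ D, a < r) (m : ℕ) :
    (digitWords r D m).card = D.card ^ m := by
  induction m with
  | zero => simp [digitWords]
  | succ m ih =>
    rw [digitWords, Finset.card_image_of_injOn (injOn_digit_append hD _), Finset.card_product, ih,
      pow_succ]

theorem sum_digitWords_succ {M : Type*} [AddCommMonoid M] {r : ℕ} {D : Finset ℕ}
    (hD : ∀ a ∈ D, a < r) (m : ℕ) (f : ℕ → M) :
    ∑ b ∈ digitWords r D (m + 1), f b = ∑ b ∈ digitWords r D m, ∑ a ∈ D, f (r * b + a) := by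
  rw [digitWords, Finset.sum_image (injOn_digit_append hD _), Finset.sum_product]

theorem digitWords_concat {r : ℕ} {D : Finset ℕ} {m l b b' : ℕ} (hb : b ∈ digitWords r D m)
    (hb' : b' ∈ digitWords r D l) : b * r ^ l + b' ∈ digitWords r D (m + l) := by
  induction l generalizing b' with
  | zero =>
    simp only [digitWords, Finset.mem_singleton] at hb'
    simpa [hb'] using hb
  | succ l ih =>
    simp only [digitWords, Finset.mem_image, Finset.mem_product, Prod.exists] at hb'
    obtain ⟨c, a, ⟨hc, ha⟩, rfl⟩ := hb'
    rw [← add_assoc, digitWords]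
    refine Finset.mem_image.2 ⟨(b * r ^ l + c, a), Finset.mem_product.2 ⟨ih hc, ha⟩, ?_⟩
    simp only
    ring

theorem repeatedDigit_mem {r a : ℕ} {D : Finset ℕ} (ha : a ∈ D) (s : ℕ) :
    repeatedDigit r a s ∈ digitWords r D s := by
  induction s with
  | zero => simp [digitWords, repeatedDigit]
  | succ s ih => exact Finset.mem_image.2 ⟨(_, a), Finset.mem_product.2 ⟨ih, ha⟩, rfl⟩

theorem repeatedDigit_add_fixedPoint {r : ℕ} (hr : 2 ≤ r) (a s : ℕ) :
    (repeatedDigit r a s : ℝ) + a / (r - 1) = r ^ s * (a / (r - 1)) := by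
  have h1 : (r : ℝ) - 1 ≠ 0 := by
    have : (2 : ℝ) ≤ r := by exact_mod_cast hr
    linarith
  induction s with
  | zero => simp [repeatedDigit]
  | succ s ih =>
    have h2 : (r : ℝ) * (a / (r - 1)) = a + a / (r - 1) := by field_simp; ring
    rw [repeatedDigit]
    push_cast
    rw [pow_succ]
    linear_combination (r : ℝ) * ih - h2

section Attractor

variable {r : ℕ} {D : Finset ℕ} {K : Set ℝ}

theorem digit_map_mem (hK : K = ⋃ a ∈ D, (fun x : ℝ => (x + a) / r) '' K) {a : ℕ} (ha : a ∈ D)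
    {x : ℝ} (hx : x ∈ K) : (x + a) / r ∈ K := by
  rw [hK]
  exact Set.mem_biUnion ha ⟨x, hx, rfl⟩

theorem digitWord_map_mem (hr : 2 ≤ r) (hK : K = ⋃ a ∈ D, (fun x : ℝ => (x + a) / r) '' K) {m : ℕ}
    {b : ℕ} (hb : b ∈ digitWords r D m) {x : ℝ} (hx : x ∈ K) : (x + b) / (r : ℝ) ^ m ∈ K := by
  have hr0 : (r : ℝ) ≠ 0 := by positivity
  induction m generalizing b x with
  | zero =>
    simp only [digitWords, Finset.mem_singleton] at hb
    simpa [hb] using hx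
  | succ m ih =>
    simp only [digitWords, Finset.mem_image, Finset.mem_product, Prod.exists] at hb
    obtain ⟨c, a, ⟨hc, ha⟩, rfl⟩ := hb
    convert ih hc (digit_map_mem hK ha hx) using 1
    push_cast
    field_simp
    ring

theorem fixedPoint_mem (hr : 2 ≤ r) (hKcomp : IsCompact K) (hKne : K.Nonempty)
    (hK : K = ⋃ a ∈ D, (fun x : ℝ => (x + a) / r) '' K) {a : ℕ} (ha : a ∈ D) :
    (a : ℝ) / (r - 1) ∈ K := by
  have hr2 : (2 : ℝ) ≤ r := by exact_mod_cast hr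
  have h1 : (r : ℝ) - 1 ≠ 0 := by linarith
  obtain ⟨y, hy, hmin⟩ := hKcomp.exists_isMinOn hKne
    (f := fun y => |y - a / (r - 1)|) (by fun_prop)
  have h := hmin (digit_map_mem hK ha hy)
  simp only [Set.mem_ofPred_eq] at h
  have heq : (y + a) / r - (a : ℝ) / (r - 1) = (y - a / (r - 1)) / r := by field_simp; ring
  rw [heq, abs_div, abs_of_pos (by linarith : (0 : ℝ) < r), le_div_iff₀ (by linarith)] at h
  have h0 : |y - (a : ℝ) / (r - 1)| = 0 := by
    nlinarith [abs_nonneg (y - (a : ℝ) / (r - 1))]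
  rw [abs_eq_zero, sub_eq_zero] at h0
  exact h0 ▸ hy

theorem measure_eq_sum_digitWords (hr : 2 ≤ r) (hD : ∀ a ∈ D, a < r) {μ : Measure ℝ}
    (hμ : ∀ A : Set ℝ, MeasurableSet A →
      μ A = ∑ a ∈ D, (D.card : ℝ≥0∞)⁻¹ * μ ((fun x : ℝ => (x + a) / r) ⁻¹' A))
    (m : ℕ) {A : Set ℝ} (hA : MeasurableSet A) :
    μ A = ∑ b ∈ digitWords r D m,
      ((D.card : ℝ≥0∞)⁻¹) ^ m * μ ((fun x : ℝ => (x + b) / (r : ℝ) ^ m) ⁻¹' A) := by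
  have hr0 : (r : ℝ) ≠ 0 := by positivity
  induction m with
  | zero => simp [digitWords]
  | succ m ih =>
    rw [ih, sum_digitWords_succ hD]
    refine Finset.sum_congr rfl fun b _ => ?_
    have hmeas : Measurable fun x : ℝ => (x + b) / (r : ℝ) ^ m := by fun_prop
    rw [hμ _ (hmeas hA), Finset.mul_sum]
    refine Finset.sum_congr rfl fun a _ => ?_
    rw [← mul_assoc, ← pow_succ, ← Set.preimage_comp]
    congr 3
    ext x
    simp only [Function.comp_apply]
    push_cast
    field_simp
    ring

end Attractor

section Product

variable {n r : ℕ}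

theorem measurable_wordMap (m : ℕ) (w : Fin n → ℕ) : Measurable (wordMap r m w) := by
  unfold wordMap
  fun_prop

theorem wordMap_wordMap (hr : 2 ≤ r) (m l : ℕ) (w v : Fin n → ℕ) (x : Fin n → ℝ) :
    wordMap r m w (wordMap r l v x) = wordMap r (m + l) (fun i => w i * r ^ l + v i) x := by
  have hr0 : (r : ℝ) ≠ 0 := by positivity
  ext i
  simp only [wordMap]
  push_cast
  field_simp
  ring

variable {D : Fin n → Finset ℕ} {μ : Fin n → Measure ℝ} [∀ j, IsProbabilityMeasure (μ j)]

theorem pi_eq_sum_wordMap (hr : 2 ≤ r) (hD : ∀ j, ∀ a ∈ D j, a < r)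
    (hμ : ∀ j, ∀ A : Set ℝ, MeasurableSet A →
      μ j A = ∑ a ∈ D j, ((D j).card : ℝ≥0∞)⁻¹ * μ j ((fun x : ℝ => (x + a) / r) ⁻¹' A))
    (m : ℕ) :
    Measure.pi μ = (∏ j, (((D j).card : ℝ≥0∞)⁻¹) ^ m) •
      ∑ w ∈ Fintype.piFinset fun j => digitWords r (D j) m,
        (Measure.pi μ).map (wordMap r m w) := by
  refine (Measure.pi_eq fun s hs => ?_)
  have hbox : ∀ w : Fin n → ℕ, (Measure.pi μ).map (wordMap r m w) (Set.univ.pi s) =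
      ∏ j, μ j ((fun x : ℝ => (x + w j) / (r : ℝ) ^ m) ⁻¹' s j) := by
    intro w
    rw [Measure.map_apply (measurable_wordMap m w) (MeasurableSet.univ_pi hs), ← Measure.pi_pi]
    rfl
  simp only [Measure.smul_apply, Measure.finsetSum_apply, hbox, smul_eq_mul]
  rw [← Finset.prod_univ_sum (fun j => digitWords r (D j) m)
    fun j b => μ j ((fun x : ℝ => (x + (b : ℝ)) / (r : ℝ) ^ m) ⁻¹' s j),
    ← Finset.prod_mul_distrib]
  refine Finset.prod_congr rfl fun j _ => ?_
  rw [measure_eq_sum_digitWords hr (hD j) (hμ j) m (hs j), Finset.mul_sum]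

theorem pi_real_eq_sum_wordMap (hr : 2 ≤ r) (hD : ∀ j, ∀ a ∈ D j, a < r)
    (hμ : ∀ j, ∀ A : Set ℝ, MeasurableSet A →
      μ j A = ∑ a ∈ D j, ((D j).card : ℝ≥0∞)⁻¹ * μ j ((fun x : ℝ => (x + a) / r) ⁻¹' A))
    (m : ℕ) {A : Set (Fin n → ℝ)} (hA : MeasurableSet A) :
    (Measure.pi μ).real A = (∏ j, (((D j).card : ℝ)⁻¹) ^ m) *
      ∑ w ∈ Fintype.piFinset fun j => digitWords r (D j) m,
        (Measure.pi μ).real (wordMap r m w ⁻¹' A) := by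
  have h := congrArg (fun ν : Measure (Fin n → ℝ) => (ν A).toReal) (pi_eq_sum_wordMap hr hD hμ m)
  simp only [Measure.smul_apply, Measure.finsetSum_apply, smul_eq_mul, ENNReal.toReal_mul,
    ENNReal.toReal_prod, ENNReal.toReal_pow, ENNReal.toReal_inv, ENNReal.toReal_natCast,
    Measure.map_apply (measurable_wordMap m _) hA] at h
  rw [measureReal_def, h, ENNReal.toReal_sum fun _ _ => measure_ne_top _ _]
  rfl

/-- If the copies of `A` inside the cylinders of level `S` all have measure at most `G`, and those
starting in coordinate `j` with `s j` times the digit `a j` are null, then `A` has measure at most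
`(1 - ∏ (#D j)^{-s j}) G`. -/
theorem pi_real_le_of_null_block (hr : 2 ≤ r) (hD : ∀ j, ∀ a ∈ D j, a < r)
    (hμ : ∀ j, ∀ A : Set ℝ, MeasurableSet A →
      μ j A = ∑ a ∈ D j, ((D j).card : ℝ≥0∞)⁻¹ * μ j ((fun x : ℝ => (x + a) / r) ⁻¹' A))
    {a : Fin n → ℕ} (ha : ∀ j, a j ∈ D j) {s : Fin n → ℕ} {S : ℕ} (hs : ∀ j, s j ≤ S)
    {A : Set (Fin n → ℝ)} (hA : MeasurableSet A) {G : ℝ}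
    (hG : ∀ v : Fin n → ℕ, (∀ j, v j ∈ digitWords r (D j) S) →
      (Measure.pi μ).real (wordMap r S v ⁻¹' A) ≤ G)
    (hnull : ∀ v : Fin n → ℕ, (∀ j, v j ∈ digitWords r (D j) (S - s j)) →
      (Measure.pi μ).real (wordMap r S
        (fun j => repeatedDigit r (a j) (s j) * r ^ (S - s j) + v j) ⁻¹' A) = 0) :
    (Measure.pi μ).real A ≤ (1 - ∏ j, (((D j).card : ℝ)⁻¹) ^ s j) * G := by
  classical
  have hpos : ∀ j, (0 : ℝ) < (D j).card := fun j => by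
    exact_mod_cast Finset.card_pos.2 ⟨_, ha j⟩
  let V := Fintype.piFinset fun j => digitWords r (D j) S
  let M := Fintype.piFinset fun j => (digitWords r (D j) (S - s j)).image
    fun b => repeatedDigit r (a j) (s j) * r ^ (S - s j) + b
  have hMV : M ⊆ V := by
    refine Fintype.piFinset_subset _ _ fun j => ?_
    intro b hb
    obtain ⟨b', hb', rfl⟩ := Finset.mem_image.1 hb
    have := digitWords_concat (repeatedDigit_mem (r := r) (ha j) (s j)) hb'
    rwa [Nat.add_sub_cancel' (hs j)] at this
  have hVcard : (V.card : ℝ) = ∏ j, ((D j).card : ℝ) ^ S := by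
    simp [V, Fintype.card_piFinset, card_digitWords (hD _)]
  have hMcard : (M.card : ℝ) = ∏ j, ((D j).card : ℝ) ^ (S - s j) := by
    simp only [M, Fintype.card_piFinset]
    push_cast
    refine Finset.prod_congr rfl fun j _ => ?_
    rw [Finset.card_image_of_injective _ (add_right_injective _), card_digitWords (hD j)]
    push_cast
    rfl
  have hM0 : ∀ w ∈ M, (Measure.pi μ).real (wordMap r S w ⁻¹' A) = 0 := by
    intro w hw
    have hw' := fun j => Finset.mem_image.1 (Fintype.mem_piFinset.1 hw j)
    choose v hv hvw using hw'
    rw [← funext hvw]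
    exact hnull v hv
  rw [pi_real_eq_sum_wordMap hr hD hμ S hA]
  have hsum : ∑ w ∈ V, (Measure.pi μ).real (wordMap r S w ⁻¹' A) ≤ ((V.card : ℝ) - M.card) * G := by
    rw [← Finset.sum_sdiff hMV, Finset.sum_eq_zero hM0, add_zero]
    refine (Finset.sum_le_card_nsmul _ _ G fun w hw => hG w fun j =>
      Fintype.mem_piFinset.1 (Finset.mem_sdiff.1 hw).1 j).trans_eq ?_
    rw [nsmul_eq_mul, Finset.card_sdiff_of_subset hMV, Nat.cast_sub (Finset.card_le_card hMV)]
  refine (mul_le_mul_of_nonneg_left hsum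
    (Finset.prod_nonneg fun j _ => by positivity)).trans_eq ?_
  rw [← mul_assoc, mul_sub, hVcard, hMcard, ← Finset.prod_mul_distrib, ← Finset.prod_mul_distrib]
  congr 2
  · refine Finset.prod_eq_one fun j _ => ?_
    rw [← mul_pow, inv_mul_cancel₀ (hpos j).ne', one_pow]
  · refine Finset.prod_congr rfl fun j _ => ?_
    have hj := (hpos j).ne'
    nth_rewrite 1 [← Nat.add_sub_cancel' (hs j)]
    rw [pow_add, mul_assoc, ← mul_pow, inv_mul_cancel₀ hj, one_pow, mul_one]

end Product

/-- There is a sequence with logarithmic gaps whose reciprocals are not summable. -/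
theorem exists_log_gaps (C E : ℝ) (hE : 0 ≤ E) (hC : 0 ≤ C) :
    ∃ m : ℕ → ℕ, m 0 = 0 ∧ (∀ k, (m k : ℝ) + (C + E * Real.log (m k + 2)) ≤ m (k + 1)) ∧
      ¬ Summable fun k => 1 / ((m k : ℝ) + 2) := by
  obtain ⟨A, hA⟩ : ∃ A : ℕ, C + E * Real.log (A + 2) + 2 * E ≤ A := by
    have hlim : Filter.Tendsto (fun A : ℕ => (A : ℝ) + 2) Filter.atTop Filter.atTop :=
      Filter.tendsto_atTop_add_const_right _ _ tendsto_natCast_atTop_atTop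
    have hsmall := hlim.eventually (Real.isLittleO_log_id_atTop.bound
      (by positivity : (0 : ℝ) < 1 / (2 * (E + 1))))
    obtain ⟨A, hA1, hA2⟩ := (hsmall.and (Filter.eventually_ge_atTop ⌈2 * (C + 2 * E + 1)⌉₊)).exists
    refine ⟨A, ?_⟩
    have hA3 : 2 * (C + 2 * E + 1) ≤ (A : ℝ) := Nat.ceil_le.1 hA2
    have hA0 : (0 : ℝ) ≤ A := Nat.cast_nonneg A
    have h1 : Real.log (A + 2) ≤ 1 / (2 * (E + 1)) * (A + 2) := by
      refine (le_abs_self _).trans ?_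
      simpa [abs_of_nonneg (by linarith : (0 : ℝ) ≤ A + 2)] using hA1
    have h2 : E * Real.log (A + 2) ≤ (A + 2) / 2 := by
      refine (mul_le_mul_of_nonneg_left h1 hE).trans ?_
      have : E * (1 / (2 * (E + 1)) * ((A : ℝ) + 2)) = E / (E + 1) * ((A + 2) / 2) := by
        field_simp
      rw [this]
      refine mul_le_of_le_one_left (by positivity) ?_
      rw [div_le_one (by positivity)]
      linarith
    linarith
  refine ⟨fun k => A * k * (Nat.log 2 k + 1), by simp, fun k => ?_, ?_⟩
  · set l := Nat.log 2 k
    have hk : k ≤ 2 ^ (l + 1) := (Nat.lt_pow_succ_log_self one_lt_two k).le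
    have hll : l + 1 ≤ 2 ^ (l + 1) := Nat.lt_two_pow_self.le
    have hle : A * k * (l + 1) + 2 ≤ (A + 2) * (2 ^ (l + 1) * 2 ^ (l + 1)) := by
      have h1 := Nat.mul_le_mul (Nat.mul_le_mul_left A hk) hll
      have h2 : 1 ≤ 2 ^ (l + 1) * 2 ^ (l + 1) := Nat.mul_pos (by positivity) (by positivity)
      nlinarith
    have hlog : Real.log ((A * k * (l + 1) : ℕ) + 2) ≤ Real.log (A + 2) + 2 * (l + 1) := by
      have hcast : (((A * k * (l + 1) : ℕ) : ℝ) + 2) ≤ (A + 2) * (2 ^ (l + 1) * 2 ^ (l + 1)) := by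
        exact_mod_cast hle
      refine (Real.log_le_log (by positivity) hcast).trans ?_
      rw [Real.log_mul (by positivity) (by positivity), Real.log_mul (by positivity)
        (by positivity), Real.log_pow]
      have h2 : Real.log 2 ≤ 1 := by linarith [Real.log_two_lt_d9]
      push_cast
      have : ((l : ℝ) + 1) * Real.log 2 ≤ l + 1 := mul_le_of_le_one_right (by positivity) h2
      linarith
    have hgap : A * k * (l + 1) + A * (l + 1) ≤ A * (k + 1) * (Nat.log 2 (k + 1) + 1) := by
      have : l ≤ Nat.log 2 (k + 1) := Nat.log_mono_right (Nat.le_succ k)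
      calc A * k * (l + 1) + A * (l + 1) = A * (k + 1) * (l + 1) := by ring
        _ ≤ _ := Nat.mul_le_mul_left _ (by omega)
    have hgap' : ((A * k * (l + 1) : ℕ) : ℝ) + A * (l + 1) ≤
        (A * (k + 1) * (Nat.log 2 (k + 1) + 1) : ℕ) := by exact_mod_cast hgap
    refine le_trans ?_ hgap'
    have hAl : (0 : ℝ) ≤ Real.log (A + 2) :=
      Real.log_nonneg (by linarith [Nat.cast_nonneg (α := ℝ) A])
    have hEl := mul_le_mul_of_nonneg_left hlog hE
    have h3 : C + E * (Real.log (A + 2) + 2 * (l + 1)) ≤ A * (l + 1) := by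
      have h4 := mul_le_mul_of_nonneg_right hA (by positivity : (0 : ℝ) ≤ (l : ℝ) + 1)
      have h5 : 0 ≤ (C + E * Real.log (A + 2)) * l := by positivity
      nlinarith
    linarith
  · rw [← summable_condensed_iff_of_nonneg (fun k => by positivity)
      (fun {a b} _ hab => by
        refine one_div_le_one_div_of_le (by positivity) ?_
        have : A * a * (Nat.log 2 a + 1) ≤ A * b * (Nat.log 2 b + 1) :=
          Nat.mul_le_mul (Nat.mul_le_mul_left _ hab)
            (Nat.add_le_add_right (Nat.log_mono_right hab) 1)
        have h : ((A * a * (Nat.log 2 a + 1) : ℕ) : ℝ) ≤ (A * b * (Nat.log 2 b + 1) : ℕ) := by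
          exact_mod_cast this
        linarith)]
    intro hsum
    refine Real.not_summable_one_div_natCast ((summable_nat_add_iff 1).1 ?_)
    refine Summable.of_nonneg_of_le (fun k => by positivity) (fun k => ?_)
      (hsum.mul_left ((A : ℝ) + 2))
    simp only [Nat.log_pow one_lt_two]
    push_cast
    rw [mul_one_div, mul_div_assoc', div_le_div_iff₀ (by positivity) (by positivity)]
    have h1 : (1 : ℝ) ≤ 2 ^ k := one_le_pow₀ one_le_two
    have h2 : (0 : ℝ) ≤ k := Nat.cast_nonneg k
    nlinarith [mul_nonneg h2 (by linarith : (0 : ℝ) ≤ 2 ^ k)]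

/-- The set of points of `∏ K_j` that are intrinsically badly approximable with constant `c`. -/
def badIntWith {n : ℕ} (K : Fin n → Set ℝ) (τ : Fin n → ℝ) (c : ℝ) : Set (Fin n → ℝ) :=
  {x | (∀ j, x j ∈ K j) ∧ ∀ (p : Fin n → ℤ) (q : ℕ), 2 ≤ q → (∀ j, ((p j : ℝ) / q) ∈ K j) →
    ∃ i, c / (q * Real.log q ^ τ i) ≤ |x i - p i / q|}

theorem measurableSet_badIntWith {n : ℕ} {K : Fin n → Set ℝ} (hK : ∀ j, IsCompact (K j))
    (τ : Fin n → ℝ) (c : ℝ) : MeasurableSet (badIntWith K τ c) := by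
  have h1 : MeasurableSet {x : Fin n → ℝ | ∀ j, x j ∈ K j} := by
    rw [Set.ofPred_forall]
    exact MeasurableSet.iInter fun j => (measurable_pi_apply j) (hK j).measurableSet
  have h2 : MeasurableSet {x : Fin n → ℝ | ∀ (p : Fin n → ℤ) (q : ℕ), 2 ≤ q →
      (∀ j, ((p j : ℝ) / q) ∈ K j) → ∃ i, c / (q * Real.log q ^ τ i) ≤ |x i - p i / q|} := by
    simp only [Set.ofPred_forall, Set.ofPred_exists]
    refine MeasurableSet.iInter fun p => MeasurableSet.iInter fun q => MeasurableSet.iInter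
      fun _ => MeasurableSet.iInter fun _ => MeasurableSet.iUnion fun i => ?_
    exact measurableSet_le measurable_const (by fun_prop)
  exact h1.inter h2

theorem badIntTau_subset_iUnion {n : ℕ} (K : Fin n → Set ℝ) (τ : Fin n → ℝ) :
    BadIntTau K τ ⊆ ⋃ N : ℕ, badIntWith K τ (1 / ((N : ℝ) + 1)) := by
  rintro x ⟨hxK, c, hc, h⟩
  obtain ⟨N, hN⟩ := exists_nat_one_div_lt hc
  refine Set.mem_iUnion.2 ⟨N, hxK, fun p q hq hp => ?_⟩
  obtain ⟨i, hi⟩ := h p q hq hp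
  refine ⟨i, le_trans ?_ hi⟩
  have : 0 ≤ Real.log q := Real.log_natCast_nonneg q
  gcongr

/-- A point whose expansion has the digit `a i` in the `s i` places following the place `m` is close
to a rational point of the fractal with denominator `r ^ m * (r ^ 2 - 1)`. -/
theorem wordMap_repeatedDigit_notMem_badIntWith {n r : ℕ} (hr : 2 ≤ r) {D : Fin n → Finset ℕ}
    {K : Fin n → Set ℝ} (hKcomp : ∀ j, IsCompact (K j)) (hKsub : ∀ j, K j ⊆ Set.Icc 0 1)
    (hKattr : ∀ j, K j = ⋃ a ∈ D j, (fun x : ℝ => (x + a) / r) '' K j)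
    {τ : Fin n → ℝ} {c : ℝ} {a : Fin n → ℕ} (ha : ∀ j, a j ∈ D j) {m S : ℕ} {s : Fin n → ℕ}
    (hs : ∀ j, s j ≤ S)
    (hlarge : ∀ j, ((r : ℝ) ^ 2 - 1) * Real.log ((r : ℝ) ^ m * (r ^ 2 - 1)) ^ τ j < c * r ^ s j)
    {w v : Fin n → ℕ} (hw : ∀ j, w j ∈ digitWords r (D j) m)
    (hv : ∀ j, v j ∈ digitWords r (D j) (S - s j)) {z : Fin n → ℝ} (hz : ∀ j, z j ∈ K j) :
    wordMap r m w (wordMap r S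
      (fun j => repeatedDigit r (a j) (s j) * r ^ (S - s j) + v j) z) ∉ badIntWith K τ c := by
  rintro ⟨-, h⟩
  have hr2 : (2 : ℝ) ≤ r := by exact_mod_cast hr
  have hr0 : (r : ℝ) ≠ 0 := by positivity
  have hr1 : (r : ℝ) - 1 ≠ 0 := by linarith
  have hrr : (r : ℝ) + 1 ≠ 0 := by positivity
  have hsq : 4 ≤ r ^ 2 := by nlinarith
  have hq : ((r ^ m * (r ^ 2 - 1) : ℕ) : ℝ) = (r : ℝ) ^ m * (r ^ 2 - 1) := by
    rw [Nat.cast_mul, Nat.cast_sub (by omega)]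
    push_cast
    rfl
  have hsq' : (r : ℝ) ^ 2 - 1 = (r - 1) * (r + 1) := by ring
  have hcenter : ∀ j, (((w j * (r ^ 2 - 1) + a j * (r + 1) : ℤ) : ℝ)) /
      ((r ^ m * (r ^ 2 - 1) : ℕ) : ℝ) = ((a j : ℝ) / (r - 1) + w j) / r ^ m := by
    intro j
    rw [hq, hsq']
    push_cast
    field_simp
    ring
  have hq2 : 2 ≤ r ^ m * (r ^ 2 - 1) := by
    have : 1 ≤ r ^ m := Nat.one_le_pow _ _ (by omega)
    calc 2 ≤ 1 * (r ^ 2 - 1) := by omega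
      _ ≤ _ := Nat.mul_le_mul_right _ this
  obtain ⟨i, hi⟩ := h (fun j => w j * (r ^ 2 - 1) + a j * (r + 1)) (r ^ m * (r ^ 2 - 1)) hq2
    fun j => by
      rw [hcenter]
      exact digitWord_map_mem hr (hKattr j) (hw j)
        (fixedPoint_mem hr (hKcomp j) ⟨_, hz j⟩ (hKattr j) (ha j))
  rw [hcenter, hq] at hi
  set u : ℝ := (z i + v i) / (r : ℝ) ^ (S - s i) with hu
  have huK : u ∈ Set.Icc (0 : ℝ) 1 := hKsub i (digitWord_map_mem hr (hKattr i) (hv i) (hz i))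
  have haK : (a i : ℝ) / (r - 1) ∈ Set.Icc (0 : ℝ) 1 :=
    hKsub i (fixedPoint_mem hr (hKcomp i) ⟨_, hz i⟩ (hKattr i) (ha i))
  have hdiff : wordMap r m w (wordMap r S
      (fun j => repeatedDigit r (a j) (s j) * r ^ (S - s j) + v j) z) i -
      ((a i : ℝ) / (r - 1) + w i) / r ^ m = (u - a i / (r - 1)) / (r ^ m * r ^ s i) := by
    have hA := repeatedDigit_add_fixedPoint hr (a i) (s i)
    have hpow : (r : ℝ) ^ S = r ^ s i * r ^ (S - s i) := by
      rw [← pow_add, Nat.add_sub_cancel' (hs i)]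
    simp only [wordMap]
    push_cast
    rw [eq_sub_of_add_eq hA, hpow, hu]
    field_simp
    ring
  have habs : |u - (a i : ℝ) / (r - 1)| ≤ 1 := by
    rw [abs_le]
    constructor <;> linarith [huK.1, huK.2, haK.1, haK.2]
  rw [hdiff, abs_div, abs_of_pos (by positivity : (0 : ℝ) < r ^ m * r ^ s i)] at hi
  have hqpos : (1 : ℝ) < r ^ m * (r ^ 2 - 1) := by
    rw [← hq]
    exact_mod_cast hq2
  have hlogpos : 0 < Real.log ((r : ℝ) ^ m * (r ^ 2 - 1)) ^ τ i :=
    Real.rpow_pos_of_pos (Real.log_pos hqpos) _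
  have hrm : (0 : ℝ) < r ^ m := by positivity
  have hi' := hi.trans (div_le_div_of_nonneg_right habs (by positivity))
  rw [div_le_div_iff₀ (mul_pos (by linarith) hlogpos) (by positivity)] at hi'
  have := mul_lt_mul_of_pos_left (hlarge i) hrm
  nlinarith

/-- The number of repeated digits needed at place `m` for a weight `t`, up to the constant `C`. -/
noncomputable def blockLength (r : ℕ) (C t : ℝ) (m : ℕ) : ℕ :=
  ⌈t * Real.logb r (m + 2) + C⌉₊

theorem blockLength_lt {r : ℕ} (hr : 2 ≤ r) {C t : ℝ} (hC : 0 ≤ C) (ht : 0 < t) (m : ℕ) :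
    (blockLength r C t m : ℝ) < t * Real.logb r (m + 2) + (C + 1) := by
  have hr2 : (2 : ℝ) ≤ r := by exact_mod_cast hr
  have : 0 ≤ Real.logb r (m + 2) :=
    Real.logb_nonneg (by linarith) (by linarith [Nat.cast_nonneg (α := ℝ) m])
  have := Nat.ceil_lt_add_one (by positivity : 0 ≤ t * Real.logb r (m + 2) + C)
  unfold blockLength
  linarith

theorem log_denominator_lt_pow_blockLength {r : ℕ} (hr : 2 ≤ r) {C t c : ℝ} (hc : 0 < c)
    (ht : 0 < t) (hC : ((r : ℝ) ^ 2 - 1) * Real.log r ^ t < c * (r : ℝ) ^ C) (m : ℕ) :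
    ((r : ℝ) ^ 2 - 1) * Real.log ((r : ℝ) ^ m * (r ^ 2 - 1)) ^ t <
      c * (r : ℝ) ^ blockLength r C t m := by
  have hr2 : (2 : ℝ) ≤ r := by exact_mod_cast hr
  have hr0 : (0 : ℝ) < r := by linarith
  have hsq : (0 : ℝ) < r ^ 2 - 1 := by nlinarith
  have hm : (0 : ℝ) < (m : ℝ) + 2 := by positivity
  have hlogr : 0 < Real.log r := Real.log_pos (by linarith)
  have hone : (1 : ℝ) ≤ r ^ m * (r ^ 2 - 1) :=
    one_le_mul_of_one_le_of_one_le (one_le_pow₀ (by linarith)) (by nlinarith)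
  have hlog : Real.log ((r : ℝ) ^ m * (r ^ 2 - 1)) ≤ (m + 2) * Real.log r := by
    calc _ ≤ Real.log ((r : ℝ) ^ (m + 2)) := by
          refine Real.log_le_log (by positivity) ?_
          rw [pow_add]
          exact mul_le_mul_of_nonneg_left (by linarith) (by positivity)
      _ = _ := by rw [Real.log_pow]; push_cast; rfl
  have hpow : ((m : ℝ) + 2) ^ t * (r : ℝ) ^ C ≤ (r : ℝ) ^ blockLength r C t m := by
    rw [← Real.rpow_natCast]
    calc ((m : ℝ) + 2) ^ t * (r : ℝ) ^ C = (r : ℝ) ^ (t * Real.logb r (m + 2) + C) := by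
          rw [Real.rpow_add hr0, mul_comm t, Real.rpow_mul hr0.le,
            Real.rpow_logb hr0 (by linarith) hm]
      _ ≤ _ := Real.rpow_le_rpow_of_exponent_le (by linarith) (Nat.le_ceil _)
  calc ((r : ℝ) ^ 2 - 1) * Real.log ((r : ℝ) ^ m * (r ^ 2 - 1)) ^ t
      ≤ ((r : ℝ) ^ 2 - 1) * ((m + 2) * Real.log r) ^ t := by
        refine mul_le_mul_of_nonneg_left ?_ hsq.le
        exact Real.rpow_le_rpow (Real.log_nonneg hone) hlog ht.le
    _ = ((m : ℝ) + 2) ^ t * (((r : ℝ) ^ 2 - 1) * Real.log r ^ t) := by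
        rw [Real.mul_rpow hm.le hlogr.le]
        ring
    _ < ((m : ℝ) + 2) ^ t * (c * (r : ℝ) ^ C) :=
        mul_lt_mul_of_pos_left hC (Real.rpow_pos_of_pos hm _)
    _ = c * (((m : ℝ) + 2) ^ t * (r : ℝ) ^ C) := by ring
    _ ≤ _ := mul_le_mul_of_nonneg_left hpow hc.le

theorem le_prod_inv_pow_blockLength {n r : ℕ} (hr : 2 ≤ r) {d : Fin n → ℕ} (hd : ∀ i, 0 < d i)
    {τ : Fin n → ℝ} (hτpos : ∀ i, 0 < τ i)
    (hτsum : ∑ i, τ i * (Real.log (d i) / Real.log r) = 1) {C : ℝ} (hC : 0 ≤ C) (m : ℕ) :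
    (∏ i, (d i : ℝ) ^ (C + 1))⁻¹ * (1 / ((m : ℝ) + 2)) ≤
      ∏ i, ((d i : ℝ)⁻¹) ^ blockLength r C (τ i) m := by
  have hm : (0 : ℝ) < (m : ℝ) + 2 := by positivity
  have hfactor : ∀ i, (d i : ℝ) ^ blockLength r C (τ i) m ≤
      (d i : ℝ) ^ (C + 1) * ((m : ℝ) + 2) ^ (τ i * (Real.log (d i) / Real.log r)) := by
    intro i
    have hdi : (1 : ℝ) ≤ d i := by exact_mod_cast hd i
    have hd0 : (0 : ℝ) < d i := by linarith
    rw [← Real.rpow_natCast]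
    refine (Real.rpow_le_rpow_of_exponent_le hdi
      (blockLength_lt hr hC (hτpos i) m).le).trans_eq ?_
    rw [Real.rpow_add hd0, mul_comm]
    congr 1
    rw [Real.rpow_def_of_pos hd0, Real.rpow_def_of_pos hm, Real.logb]
    ring_nf
  have hprod : ∏ i, (d i : ℝ) ^ blockLength r C (τ i) m ≤
      (∏ i, (d i : ℝ) ^ (C + 1)) * ((m : ℝ) + 2) := by
    refine (Finset.prod_le_prod (fun i _ => by positivity) fun i _ => hfactor i).trans_eq ?_
    rw [Finset.prod_mul_distrib, ← Real.rpow_sum_of_pos hm, hτsum, Real.rpow_one]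
  simp only [inv_pow, Finset.prod_inv_distrib]
  rw [one_div, ← mul_inv]
  exact inv_anti₀ (Finset.prod_pos fun i _ => pow_pos (by exact_mod_cast hd i) _) hprod

theorem pi_badIntWith_eq_zero {n r : ℕ} (hr : 2 ≤ r) {D : Fin n → Finset ℕ}
    (hDne : ∀ j, (D j).Nonempty) (hD : ∀ j, ∀ a ∈ D j, a < r) {K : Fin n → Set ℝ}
    (hKcomp : ∀ j, IsCompact (K j)) (hKsub : ∀ j, K j ⊆ Set.Icc 0 1)
    (hKattr : ∀ j, K j = ⋃ a ∈ D j, (fun x : ℝ => (x + a) / r) '' K j)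
    {μ : Fin n → Measure ℝ} [∀ j, IsProbabilityMeasure (μ j)] (hμK : ∀ j, μ j (K j) = 1)
    (hμ : ∀ j, ∀ A : Set ℝ, MeasurableSet A →
      μ j A = ∑ a ∈ D j, ((D j).card : ℝ≥0∞)⁻¹ * μ j ((fun x : ℝ => (x + a) / r) ⁻¹' A))
    {τ : Fin n → ℝ} (hτpos : ∀ i, 0 < τ i)
    (hτsum : ∑ i, τ i * (Real.log (D i).card / Real.log r) = 1) {c : ℝ} (hc : 0 < c) :
    Measure.pi μ (badIntWith K τ c) = 0 := by
  have hr2 : (2 : ℝ) ≤ r := by exact_mod_cast hr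
  have hlogr : 0 < Real.log r := Real.log_pos (by linarith)
  choose a ha using hDne
  have hd : ∀ i, 0 < (D i).card := fun i => Finset.card_pos.2 ⟨_, ha i⟩
  have hae : ∀ᵐ z ∂Measure.pi μ, ∀ j, z j ∈ K j := by
    rw [Filter.eventually_all]
    intro j
    have hj : ∀ᵐ x ∂μ j, x ∈ K j := (prob_compl_eq_zero_iff (hKcomp j).measurableSet).2 (hμK j)
    exact (measurePreserving_eval μ j).quasiMeasurePreserving.ae hj
  obtain ⟨C, hC0, hC⟩ : ∃ C : ℝ, 0 ≤ C ∧
      ∀ i, ((r : ℝ) ^ 2 - 1) * Real.log r ^ τ i < c * (r : ℝ) ^ C := by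
    have hlim : Filter.Tendsto (fun C : ℝ => c * (r : ℝ) ^ C) Filter.atTop Filter.atTop :=
      (tendsto_rpow_atTop_of_base_gt_one r (by linarith)).const_mul_atTop hc
    exact ((Filter.eventually_ge_atTop 0).and (Filter.eventually_all.2 fun i =>
      hlim.eventually_gt_atTop (((r : ℝ) ^ 2 - 1) * Real.log r ^ τ i))).exists
  set κ : ℝ := (∏ i, ((D i).card : ℝ) ^ (C + 1))⁻¹
  have hκpos : 0 < κ :=
    inv_pos.2 (Finset.prod_pos fun i _ => Real.rpow_pos_of_pos (by exact_mod_cast hd i) _)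
  have hτnn : 0 ≤ ∑ i, τ i := Finset.sum_nonneg fun i _ => (hτpos i).le
  obtain ⟨m, hm0, hgap, hdiv⟩ := exists_log_gaps (C + 1) ((∑ i, τ i) / Real.log r)
    (by positivity) (by positivity)
  have hmono : ∀ k, m k ≤ m (k + 1) := fun k => by
    have h1 : 0 ≤ Real.log ((m k : ℝ) + 2) :=
      Real.log_nonneg (by linarith [Nat.cast_nonneg (α := ℝ) (m k)])
    have h2 : 0 ≤ (∑ i, τ i) / Real.log r * Real.log ((m k : ℝ) + 2) := by positivity
    exact_mod_cast (by linarith [hgap k] : (m k : ℝ) ≤ m (k + 1))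
  have hblock : ∀ k i, blockLength r C (τ i) (m k) ≤ m (k + 1) - m k := fun k i => by
    have h1 : 0 ≤ Real.log ((m k : ℝ) + 2) :=
      Real.log_nonneg (by linarith [Nat.cast_nonneg (α := ℝ) (m k)])
    have h2 := blockLength_lt hr hC0 (hτpos i) (m k)
    have h3 : τ i * Real.logb r (m k + 2) ≤
        (∑ i, τ i) / Real.log r * Real.log ((m k : ℝ) + 2) := by
      rw [Real.logb, div_mul_eq_mul_div, mul_div_assoc]
      exact mul_le_mul_of_nonneg_right
        (Finset.single_le_sum (fun i _ => (hτpos i).le) (Finset.mem_univ i)) (by positivity)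
    have h4 : ((blockLength r C (τ i) (m k) : ℕ) : ℝ) + m k ≤ m (k + 1) := by
      linarith [hgap k]
    have h5 : blockLength r C (τ i) (m k) + m k ≤ m (k + 1) := by exact_mod_cast h4
    omega
  have hmeas := measurableSet_badIntWith hKcomp τ c
  have hdecay : ∀ N k, ∀ w : Fin n → ℕ, (∀ j, w j ∈ digitWords r (D j) (m k)) →
      (Measure.pi μ).real (wordMap r (m k) w ⁻¹' badIntWith K τ c) ≤
        Real.exp (-∑ j ∈ Finset.range N, κ * (1 / ((m (k + j) : ℝ) + 2))) := by
    intro N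
    induction N with
    | zero => intro k w _; simp
    | succ N ih =>
      intro k w hw
      refine (pi_real_le_of_null_block hr hD hμ ha (hblock k) (measurable_wordMap _ w hmeas)
        (G := Real.exp (-∑ j ∈ Finset.range N, κ * (1 / ((m (k + 1 + j) : ℝ) + 2))))
        ?_ ?_).trans ?_
      · intro v hv
        have hcomp : wordMap r (m (k + 1) - m k) v ⁻¹' (wordMap r (m k) w ⁻¹' badIntWith K τ c) =
            wordMap r (m (k + 1)) (fun i => w i * r ^ (m (k + 1) - m k) + v i) ⁻¹'
              badIntWith K τ c := by
          ext x
          simp only [Set.mem_preimage, wordMap_wordMap hr, Nat.add_sub_cancel' (hmono k)]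
        rw [hcomp]
        refine ih (k + 1) _ fun j => ?_
        have := digitWords_concat (hw j) (hv j)
        rwa [Nat.add_sub_cancel' (hmono k)] at this
      · intro v hv
        rw [measureReal_eq_zero_iff, measure_eq_zero_iff_ae_notMem]
        filter_upwards [hae] with z hz
        exact wordMap_repeatedDigit_notMem_badIntWith hr hKcomp hKsub hKattr ha (hblock k)
          (fun j => log_denominator_lt_pow_blockLength hr hc (hτpos j) (hC j) (m k)) hw hv hz
      · rw [Finset.sum_range_succ', neg_add, Real.exp_add, mul_comm (Real.exp _)]
        simp only [add_zero, add_assoc, add_comm 1]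
        refine mul_le_mul_of_nonneg_right ?_ (Real.exp_pos _).le
        refine le_trans ?_ (Real.one_sub_le_exp_neg _)
        linarith [le_prod_inv_pow_blockLength hr hd hτpos hτsum hC0 (m k)]
  have hzero : (Measure.pi μ).real (badIntWith K τ c) ≤ 0 := by
    have hlim : Filter.Tendsto (fun N => Real.exp (-∑ j ∈ Finset.range N,
        κ * (1 / ((m (0 + j) : ℝ) + 2)))) Filter.atTop (nhds 0) := by
      refine Real.tendsto_exp_neg_atTop_nhds_zero.comp ?_
      simp only [zero_add, ← Finset.mul_sum]
      exact ((not_summable_iff_tendsto_nat_atTop_of_nonneg fun k => by positivity).1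
        hdiv).const_mul_atTop hκpos
    refine ge_of_tendsto' hlim fun N => ?_
    have h := hdecay N 0 0 fun j => by simp [hm0, digitWords]
    have hid : wordMap r (m 0) (0 : Fin n → ℕ) = id := by
      ext x i
      simp [wordMap, hm0]
    rwa [hid, Set.preimage_id] at h
  exact (measureReal_eq_zero_iff (measure_ne_top _ _)).1 (le_antisymm hzero measureReal_nonneg)

/-- Theorem: for the self-similar fractal `K = ∏ K_j` with canonical self-similar
measure `μ` and positive weights `τ` with `∑ τ_i γ_i = 1`, the set of weighted
intrinsically badly approximable points is `μ`-null. -/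
theorem badIntTau_measure_zero (r n : ℕ) (hr : 2 ≤ r) (hn : 0 < n)
    (D : Fin n → Finset ℕ) (hDne : ∀ j, (D j).Nonempty) (hD : ∀ j, ∀ a ∈ D j, a ≤ r - 1)
    (K : Fin n → Set ℝ)
    (hKcomp : ∀ j, IsCompact (K j)) (hKne : ∀ j, (K j).Nonempty)
    (hKsub : ∀ j, K j ⊆ Set.Icc 0 1)
    (hKattr : ∀ j, K j = ⋃ a ∈ D j, (fun x : ℝ => (x + a) / r) '' K j)
    (μ : Fin n → Measure ℝ) [∀ j, IsProbabilityMeasure (μ j)]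
    (hμK : ∀ j, μ j (K j) = 1)
    (hμss : ∀ j, ∀ A : Set ℝ, MeasurableSet A →
      μ j A = ∑ a ∈ D j, ((D j).card : ℝ≥0∞)⁻¹ * μ j ((fun x : ℝ => (x + a) / r) ⁻¹' A))
    (τ : Fin n → ℝ) (hτpos : ∀ i, 0 < τ i)
    (hτsum : ∑ i, τ i * (Real.log (D i).card / Real.log r) = 1) :
    Measure.pi μ (BadIntTau K τ) = 0 := by
  have hDlt : ∀ j, ∀ a ∈ D j, a < r := fun j a ha => by
    have := hD j a ha
    omega
  refine measure_mono_null (badIntTau_subset_iUnion K τ) (measure_iUnion_null fun N => ?_)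
  exact pi_badIntWith_eq_zero hr hDne hDlt hKcomp hKsub hKattr hμK hμss hτpos hτsum
    (by positivity)
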